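/- Suppose 0 < γ' ≤ γ_n ≤ γ < 1 for all n ≥ 0, let {(x_n, y_n)}_{n=0}^∞ be a solution of the system with positive initial conditions, and let {k_i}_{i=1}^∞ be a sequence of indices such that {x_{k_i}} is bounded and lim_{i→∞} w_{k_i} = M ∈ (0,∞). Then for any strictly increasing sequences of positive integers {i_s}_{s=1}^∞ and {n_j}_{j=1}^∞, the iterated limit lim_{s→∞} lim_{j→∞} φ(k_{i_s}, n_j) exists and equals M. -/

import Mathlib

open Filter Topology

/-- The coefficient sequence extended to `ℤ` by the convention `γ₋₁ := γ₀`. -/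
noncomputable def gext (γ : ℕ → ℝ) : ℤ → ℝ := fun j => if j < 0 then γ 0 else γ j.toNat

/-- `μ(i,1) = 1` and `μ(i,k) = ∏_{j=i-1}^{i+k-3} γ_j` for `k ≥ 2`. -/
noncomputable def mu (γ : ℕ → ℝ) (i k : ℕ) : ℝ :=
  ∏ t ∈ Finset.range (k - 1), gext γ ((i : ℤ) - 1 + (t : ℤ))

/-- `φ(i,n) = ∑_{k=1}^n μ(i,k) x_{i+k}`. -/
noncomputable def phi (γ x : ℕ → ℝ) (i n : ℕ) : ℝ :=
  ∑ k ∈ Finset.Icc 1 n, mu γ i k * x (i + k)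

/-- `w_n = (γ_{n-1} + x_n)/y_n`, where `γ₋₁ := γ₀` (Nat subtraction). -/
noncomputable def wseq (γ x y : ℕ → ℝ) (n : ℕ) : ℝ := (γ (n - 1) + x n) / y n

theorem gext_natCast_sub_one_add (γ : ℕ → ℝ) (i t : ℕ) :
    gext γ ((i : ℤ) - 1 + (t : ℤ)) = γ (i + t - 1) := by
  unfold gext
  split_ifs with h
  · congr 1
    omega
  · congr 1
    omega

theorem mu_add_two (γ : ℕ → ℝ) (i n : ℕ) :
    mu γ i (n + 2) = mu γ i (n + 1) * γ (i + n - 1) := by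
  simp [mu, Finset.prod_range_succ, gext_natCast_sub_one_add]

theorem mu_pos {γ : ℕ → ℝ} (hγ : ∀ n, 0 < γ n) (i n : ℕ) : 0 < mu γ i n := by
  unfold mu
  refine Finset.prod_pos fun t _ => ?_
  rw [gext_natCast_sub_one_add]
  exact hγ _

theorem mu_succ_le_pow {γ : ℕ → ℝ} {g : ℝ} (hγ : ∀ n, 0 < γ n) (hg : ∀ n, γ n ≤ g) (i n : ℕ) :
    mu γ i (n + 1) ≤ g ^ n := by
  induction n with
  | zero => simp [mu]
  | succ n ih =>
    rw [mu_add_two, pow_succ]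
    exact mul_le_mul ih (hg _) (hγ _).le (pow_nonneg ((hγ 0).le.trans (hg 0)) n)

theorem phi_succ (γ x : ℕ → ℝ) (i n : ℕ) :
    phi γ x i (n + 1) = phi γ x i n + mu γ i (n + 1) * x (i + n + 1) := by
  unfold phi
  rw [Finset.sum_Icc_succ_top (by omega), add_assoc]

section System

variable {γ x y : ℕ → ℝ}

theorem solution_pos (hγ : ∀ n, 0 < γ n) (hx0 : 0 < x 0) (hy0 : 0 < y 0)
    (hx : ∀ n, x (n + 1) = x n / y n) (hy : ∀ n, y (n + 1) = x n + γ n * y n) (n : ℕ) :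
    0 < x n ∧ 0 < y n := by
  induction n with
  | zero => exact ⟨hx0, hy0⟩
  | succ n ih =>
    obtain ⟨hxn, hyn⟩ := ih
    have := hγ n
    rw [hx, hy]
    constructor <;> positivity

theorem wseq_succ (hxp : ∀ n, 0 < x n) (hγ : ∀ n, 0 < γ n) (hyp : ∀ n, 0 < y n)
    (hx : ∀ n, x (n + 1) = x n / y n) (hy : ∀ n, y (n + 1) = x n + γ n * y n) (n : ℕ) :
    wseq γ x y (n + 1) = 1 / y n := by
  have h1 := hyp n
  have h2 : 0 < x n + γ n * y n := add_pos (hxp n) (mul_pos (hγ n) h1)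
  rw [wseq, hx, hy, Nat.add_sub_cancel]
  field_simp
  ring

theorem wseq_eq (hxp : ∀ n, 0 < x n) (hγ : ∀ n, 0 < γ n) (hyp : ∀ n, 0 < y n)
    (hx : ∀ n, x (n + 1) = x n / y n) (hy : ∀ n, y (n + 1) = x n + γ n * y n) (n : ℕ) :
    wseq γ x y n = x (n + 1) + γ (n - 1) * wseq γ x y (n + 1) := by
  rw [wseq_succ hxp hγ hyp hx hy, hx, wseq]
  ring

theorem phi_add_mu_mul_wseq (hxp : ∀ n, 0 < x n) (hγ : ∀ n, 0 < γ n) (hyp : ∀ n, 0 < y n)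
    (hx : ∀ n, x (n + 1) = x n / y n) (hy : ∀ n, y (n + 1) = x n + γ n * y n) (i n : ℕ) :
    phi γ x i n + mu γ i (n + 1) * wseq γ x y (i + n) = wseq γ x y i := by
  induction n with
  | zero => simp [phi, mu]
  | succ n ih =>
    rw [← ih, wseq_eq hxp hγ hyp hx hy (i + n), phi_succ, mu_add_two, ← add_assoc i n 1]
    ring

/-- If `y` tended to `0`, then `x` would eventually increase, contradicting `x n ≤ y (n + 1)`. -/
theorem not_tendsto_y_zero (hxp : ∀ n, 0 < x n) (hγ : ∀ n, 0 < γ n) (hyp : ∀ n, 0 < y n)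
    (hx : ∀ n, x (n + 1) = x n / y n) (hy : ∀ n, y (n + 1) = x n + γ n * y n) :
    ¬ Tendsto y atTop (𝓝 0) := by
  intro h
  obtain ⟨N, hN⟩ := eventually_atTop.1 (h.eventually_lt_const one_pos)
  have hmono : ∀ n, N ≤ n → x N ≤ x n := by
    intro n hn
    induction n, hn using Nat.le_induction with
    | base => exact le_rfl
    | succ n hn ih =>
      rw [hx]
      exact ih.trans (le_div_self (hxp n).le (hyp n) (hN n hn).le)
  obtain ⟨K, hK⟩ := eventually_atTop.1 (h.eventually_lt_const (hxp N))
  have h1 := hK (max N K + 1) (by omega)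
  have h2 := hmono (max N K) (by omega)
  have h3 := mul_pos (hγ (max N K)) (hyp (max N K))
  rw [hy] at h1
  linarith

theorem tendsto_mu_mul_wseq {g : ℝ} (hg : ∀ n, γ n ≤ g) (hg1 : g < 1)
    (hxp : ∀ n, 0 < x n) (hγ : ∀ n, 0 < γ n) (hyp : ∀ n, 0 < y n)
    (hx : ∀ n, x (n + 1) = x n / y n) (hy : ∀ n, y (n + 1) = x n + γ n * y n) (i : ℕ) :
    Tendsto (fun n => mu γ i (n + 1) * wseq γ x y (i + n)) atTop (𝓝 0) := by
  have hpos : ∀ n, 0 < mu γ i (n + 1) * wseq γ x y (i + n) := fun n =>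
    mul_pos (mu_pos hγ _ _) (div_pos (add_pos (hγ _) (hxp _)) (hyp _))
  have hanti : Antitone fun n => mu γ i (n + 1) * wseq γ x y (i + n) := by
    refine antitone_nat_of_succ_le fun n => ?_
    have h1 := phi_add_mu_mul_wseq hxp hγ hyp hx hy i n
    have h2 := phi_add_mu_mul_wseq hxp hγ hyp hx hy i (n + 1)
    have h3 := mul_pos (mu_pos hγ i (n + 1)) (hxp (i + n + 1))
    rw [phi_succ] at h2
    linarith
  have hsmall : ∀ ε > 0, ∃ n, mu γ i (n + 1) * wseq γ x y (i + n) < ε := by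
    intro ε hε
    by_contra! hcon
    refine not_tendsto_y_zero hxp hγ hyp hx hy ((tendsto_add_atTop_iff_nat i).1 ?_)
    have hlim : Tendsto (fun n => g ^ (n + 1) / ε) atTop (𝓝 0) := by
      simpa using ((tendsto_add_atTop_iff_nat 1).2
        (tendsto_pow_atTop_nhds_zero_of_lt_one ((hγ 0).le.trans (hg 0)) hg1)).div_const ε
    refine squeeze_zero (fun n => (hyp _).le) (fun n => ?_) hlim
    have h1 := hcon (n + 1)
    rw [← add_assoc, wseq_succ hxp hγ hyp hx hy, mul_one_div, le_div_iff₀ (hyp _)] at h1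
    rw [le_div_iff₀ hε, add_comm n i, mul_comm]
    exact h1.trans (mu_succ_le_pow hγ hg i (n + 1))
  refine tendsto_order.2 ⟨fun a ha => .of_forall fun n => ha.trans (hpos n), fun ε hε => ?_⟩
  obtain ⟨N, hN⟩ := hsmall ε hε
  exact eventually_atTop.2 ⟨N, fun n hn => (hanti hn).trans_lt hN⟩

theorem tendsto_phi {g : ℝ} (hg : ∀ n, γ n ≤ g) (hg1 : g < 1)
    (hxp : ∀ n, 0 < x n) (hγ : ∀ n, 0 < γ n) (hyp : ∀ n, 0 < y n)
    (hx : ∀ n, x (n + 1) = x n / y n) (hy : ∀ n, y (n + 1) = x n + γ n * y n) (i : ℕ) :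
    Tendsto (phi γ x i) atTop (𝓝 (wseq γ x y i)) := by
  have h := (tendsto_mu_mul_wseq hg hg1 hxp hγ hyp hx hy i).const_sub (wseq γ x y i)
  rw [sub_zero] at h
  exact h.congr fun n => by rw [← phi_add_mu_mul_wseq hxp hγ hyp hx hy i n, add_sub_cancel_right]

end System

/-- Under the standing hypotheses, if `{x_{kᵢ}}` is bounded and `w_{kᵢ} → M ∈ (0,∞)`,
then for any strictly increasing sequences `{i_s}` and `{n_j}`, the iterated limit
`lim_{s→∞} lim_{j→∞} φ(k_{i_s}, n_j)` exists and equals `M`. -/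
theorem stmt6 (γ x y : ℕ → ℝ) (γ' g : ℝ)
    (hγ' : 0 < γ') (hγlo : ∀ n, γ' ≤ γ n) (hγhi : ∀ n, γ n ≤ g) (hg : g < 1)
    (hγpos : ∀ n, 0 < γ n)
    (hx0 : 0 < x 0) (hy0 : 0 < y 0)
    (hx : ∀ n, x (n + 1) = x n / y n)
    (hy : ∀ n, y (n + 1) = x n + γ n * y n)
    (k : ℕ → ℕ) (M : ℝ) (hM : 0 < M)
    (hkbdd : ∃ C : ℝ, ∀ i, x (k i) ≤ C)
    (hkw : Filter.Tendsto (fun i => wseq γ x y (k i)) Filter.atTop (nhds M))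
    (is ns : ℕ → ℕ) (his : StrictMono is) (hns : StrictMono ns) :
    ∃ L : ℕ → ℝ,
      (∀ s : ℕ, Filter.Tendsto (fun j => phi γ x (k (is s)) (ns j)) Filter.atTop (nhds (L s))) ∧
      Filter.Tendsto L Filter.atTop (nhds M) := by
  have hpos := solution_pos hγpos hx0 hy0 hx hy
  exact ⟨fun s => wseq γ x y (k (is s)), fun s =>
    (tendsto_phi hγhi hg (fun n => (hpos n).1) hγpos (fun n => (hpos n).2) hx hy _).comp
      hns.tendsto_atTop, hkw.comp his.tendsto_atTop⟩
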